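/- Let l ≥ 0 and −l ≤ m ≤ l be integers, with the convention that Y_{l'm'} = 0 whenever l' < 0 or |m'| > l'. Then for all θ ∈ [0,π] and φ ∈ [0,2π), sin θ · e^{−iφ} · Y_{lm}(θ,φ) = √(((l−m+1)(l−m+2))/((2l+1)(2l+3)))·Y_{l+1,m−1}(θ,φ) − √(((l+m)(l+m−1))/((2l−1)(2l+1)))·Y_{l−1,m−1}(θ,φ). -/

import Mathlib

open scoped Real
open Complex

noncomputable section

/-- Legendre polynomial `P_l` via Rodrigues' formula. -/
def legendreP (l : ℕ) (x : ℝ) : ℝ :=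
  (1 / (2 ^ l * (Nat.factorial l : ℝ))) * iteratedDeriv l (fun y => (y ^ 2 - 1) ^ l) x

/-- Associated Legendre function `P_l^m` for `0 ≤ m ≤ l`. -/
def assocLegendreNat (l m : ℕ) (x : ℝ) : ℝ :=
  (-1 : ℝ) ^ m * (Real.sqrt (1 - x ^ 2)) ^ m * iteratedDeriv m (legendreP l) x

/-- Associated Legendre function `P_l^m` for integer `m`
    (negative `m` via `P_l^{-m} = (-1)^m ((l-m)!/(l+m)!) P_l^m`). -/
def assocLegendre (l : ℕ) (m : ℤ) (x : ℝ) : ℝ :=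
  if 0 ≤ m then assocLegendreNat l m.toNat x
  else
    (-1 : ℝ) ^ m.natAbs *
      ((Nat.factorial (l - m.natAbs) : ℝ) / (Nat.factorial (l + m.natAbs) : ℝ)) *
      assocLegendreNat l m.natAbs x

/-- Spherical harmonic `Y_{lm}(θ,φ)`; by convention it is `0` when `l < 0` or `|m| > l`. -/
def sphHarm (l m : ℤ) (θ φ : ℝ) : ℂ :=
  if 0 ≤ l ∧ |m| ≤ l then
    ((Real.sqrt ((2 * (l : ℝ) + 1) / (4 * Real.pi) *
        ((Nat.factorial (l - m).toNat : ℝ) / (Nat.factorial (l + m).toNat : ℝ))) *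
      assocLegendre l.toNat m (Real.cos θ) : ℝ) : ℂ) *
      Complex.exp (Complex.I * (m : ℂ) * (φ : ℂ))
  else 0

/-- Spin-weighted spherical harmonic `Y_{s,lm}(θ,φ)`;
    by convention it is `0` when `l < |s|` or `|m| > l`. -/
def spinSphHarm (s l m : ℤ) (θ φ : ℝ) : ℂ :=
  if |s| ≤ l ∧ |m| ≤ l then
    ((Real.sqrt ((2 * (l : ℝ) + 1) / (4 * Real.pi) *
          ((Nat.factorial (l + m).toNat : ℝ) * (Nat.factorial (l - m).toNat : ℝ)) /
          ((Nat.factorial (l + s).toNat : ℝ) * (Nat.factorial (l - s).toNat : ℝ))) *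
        Real.sin (θ / 2) ^ (2 * l).toNat : ℝ) : ℂ) *
      Complex.exp (Complex.I * (m : ℂ) * (φ : ℂ)) *
      ∑ r ∈ Finset.Icc (0 : ℤ) (l - s),
        if 0 ≤ r + s - m ∧ r + s - m ≤ l + s then
          ((((l - s).toNat.choose r.toNat : ℝ) * ((l + s).toNat.choose (r + s - m).toNat : ℝ) : ℝ) : ℂ) *
            (-1 : ℂ) ^ (l - r - s) * ((((Real.tan (θ / 2))⁻¹ : ℝ) ^ (2 * r + s - m) : ℝ) : ℂ)
        else 0
  else 0

/-- Integral of a function over the sphere: `∫ f dΩ = ∫₀^{2π} ∫₀^π f(θ,φ) sin θ dθ dφ`. -/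
def sphereIntegral (f : ℝ → ℝ → ℂ) : ℂ :=
  ∫ φ in (0 : ℝ)..(2 * Real.pi), ∫ θ in (0 : ℝ)..Real.pi, f θ φ * ((Real.sin θ : ℝ) : ℂ)

/-- The spin-raising operator `ð` acting on a function of spin weight `s`:
    `ð η = -(sin θ)^s (∂_θ + (i / sin θ) ∂_φ) ((sin θ)^{-s} η)`. -/
def eth (s : ℤ) (η : ℝ → ℝ → ℂ) : ℝ → ℝ → ℂ := fun θ φ =>
  -(((Real.sin θ : ℝ) : ℂ) ^ s) *
    (deriv (fun t => (((Real.sin t : ℝ) : ℂ) ^ (-s)) * η t φ) θ +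
      (Complex.I / ((Real.sin θ : ℝ) : ℂ)) *
        deriv (fun p => (((Real.sin θ : ℝ) : ℂ) ^ (-s)) * η θ p) φ)

/-- The spin-lowering operator `ð̄` acting on a function of spin weight `s`:
    `ð̄ η = -(sin θ)^{-s} (∂_θ - (i / sin θ) ∂_φ) ((sin θ)^s η)`. -/
def ethBar (s : ℤ) (η : ℝ → ℝ → ℂ) : ℝ → ℝ → ℂ := fun θ φ =>
  -(((Real.sin θ : ℝ) : ℂ) ^ (-s)) *
    (deriv (fun t => (((Real.sin t : ℝ) : ℂ) ^ s) * η t φ) θ -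
      (Complex.I / ((Real.sin θ : ℝ) : ℂ)) *
        deriv (fun p => (((Real.sin θ : ℝ) : ℂ) ^ s) * η θ p) φ)

end

open Polynomial in
/-- The Legendre polynomial `P_l` as an element of `ℝ[X]`, via Rodrigues' formula. -/
noncomputable def legendrePoly (l : ℕ) : ℝ[X] :=
  C (1 / (2 ^ l * (Nat.factorial l : ℝ))) * derivative^[l] ((X ^ 2 - 1) ^ l)

open Polynomial in
/-- The antiderivative `((P_{n+2} - P_n) / (2n+3))` of `P_{n+1}`, in Rodrigues form. -/
noncomputable def legendrePolyPrimitive (n : ℕ) : ℝ[X] :=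
  C (1 / (2 ^ (n + 1) * (Nat.factorial (n + 1) : ℝ))) * derivative^[n] ((X ^ 2 - 1) ^ (n + 1))

section LegendrePoly

open Polynomial

theorem iteratedDeriv_polynomial_eval (p : ℝ[X]) (n : ℕ) :
    iteratedDeriv n (fun x => p.eval x) = fun x => (derivative^[n] p).eval x := by
  induction n with
  | zero => simp
  | succ n ih =>
    rw [iteratedDeriv_succ, ih]
    ext x
    rw [Polynomial.deriv, Function.iterate_succ_apply']

theorem legendreP_eq_eval (l : ℕ) : legendreP l = fun x => (legendrePoly l).eval x := by
  ext x
  have h : (fun y : ℝ => (y ^ 2 - 1) ^ l) = fun y => ((X ^ 2 - 1 : ℝ[X]) ^ l).eval y := by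
    ext y; simp
  rw [legendreP, h, iteratedDeriv_polynomial_eval, legendrePoly, eval_mul, eval_C]

theorem derivative_legendrePolyPrimitive (n : ℕ) :
    derivative (legendrePolyPrimitive n) = legendrePoly (n + 1) := by
  rw [legendrePolyPrimitive, legendrePoly, derivative_C_mul, Function.iterate_succ_apply']

theorem derivative_X_sq_sub_one_pow (n : ℕ) :
    derivative ((X ^ 2 - 1 : ℝ[X]) ^ (n + 1)) =
      C (2 * ((n : ℝ) + 1)) * ((X ^ 2 - 1) ^ n * X) := by
  simp only [derivative_pow_succ, derivative_sub, derivative_X, derivative_one, map_mul,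
    map_add, map_natCast, map_ofNat, map_one]
  push_cast
  ring

theorem rodrigues_const_succ (n : ℕ) :
    1 / (2 ^ (n + 1) * (Nat.factorial (n + 1) : ℝ)) * (2 * ((n : ℝ) + 1)) =
      1 / (2 ^ n * (Nat.factorial n : ℝ)) := by
  rw [Nat.factorial_succ]
  push_cast
  field_simp
  ring

theorem legendrePoly_add_two (n : ℕ) :
    legendrePoly (n + 2) =
      X * legendrePoly (n + 1) + C ((n : ℝ) + 1) * legendrePolyPrimitive n := by
  rw [legendrePoly, Function.iterate_succ_apply, derivative_X_sq_sub_one_pow,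
    iterate_derivative_C_mul, ← mul_assoc, ← C_mul, rodrigues_const_succ,
    iterate_derivative_mul_X, legendrePoly, legendrePolyPrimitive]
  simp only [nsmul_eq_mul, Nat.add_sub_cancel, map_add, map_natCast, map_one]
  push_cast
  ring

theorem mul_legendrePolyPrimitive (n : ℕ) :
    C (2 * (n : ℝ) + 3) * legendrePolyPrimitive n = legendrePoly (n + 2) - legendrePoly n := by
  have h : derivative (derivative ((X ^ 2 - 1 : ℝ[X]) ^ (n + 2))) =
      C (2 * (((n + 1 : ℕ) : ℝ) + 1)) * (C (2 * (n : ℝ) + 3) * (X ^ 2 - 1) ^ (n + 1) +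
        C (2 * ((n : ℝ) + 1)) * (X ^ 2 - 1) ^ n) := by
    rw [derivative_X_sq_sub_one_pow, derivative_C_mul, derivative_mul,
      derivative_X_sq_sub_one_pow, derivative_X]
    congr 1
    simp only [map_mul, map_add, map_natCast, map_ofNat, map_one]
    ring
  rw [legendrePoly, Function.iterate_succ_apply, Function.iterate_succ_apply, h,
    iterate_derivative_C_mul, ← mul_assoc, ← C_mul, rodrigues_const_succ,
    iterate_map_add, iterate_derivative_C_mul, iterate_derivative_C_mul, mul_add,
    ← mul_assoc _ (C (2 * ((n : ℝ) + 1))), ← C_mul, rodrigues_const_succ,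
    legendrePoly, legendrePolyPrimitive]
  ring

theorem X_sq_sub_one_mul_derivative_legendrePoly (n : ℕ) :
    (X ^ 2 - 1) * derivative (legendrePoly (n + 1)) =
      C (((n : ℝ) + 1) * ((n : ℝ) + 2)) * legendrePolyPrimitive n := by
  set u : ℝ[X] := (X ^ 2 - 1) ^ (n + 1) with hu
  have h : derivative u * X * X - derivative u = C (2 * ((n : ℝ) + 1)) * (u * X) := by
    rw [hu, derivative_X_sq_sub_one_pow]
    ring
  have h2 := congrArg (derivative^[n + 1]) h
  rw [iterate_derivative_sub, iterate_derivative_C_mul, iterate_derivative_mul_X,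
    iterate_derivative_mul_X, iterate_derivative_mul_X, Nat.add_sub_cancel,
    iterate_derivative_mul_X, Nat.add_sub_cancel] at h2
  simp only [← Function.iterate_succ_apply] at h2
  have hn : (n : ℝ[X]) * derivative^[n - 1 + 1] u = n * derivative^[n] u := by
    cases n <;> simp
  rw [legendrePoly, legendrePolyPrimitive, ← hu, derivative_C_mul,
    ← Function.iterate_succ_apply' derivative]
  simp only [nsmul_eq_mul, map_mul, map_add, map_natCast, map_ofNat, map_one] at h2 ⊢
  push_cast at h2
  simp only [Nat.succ_eq_add_one] at h2 ⊢
  linear_combination C (1 / (2 ^ (n + 1) * (Nat.factorial (n + 1) : ℝ))) *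
    (h2 - ((n : ℝ[X]) + 1) * hn)

theorem iterate_derivative_legendrePoly_sub (n k : ℕ) :
    C (2 * (n : ℝ) + 3) * derivative^[k] (legendrePoly (n + 1)) =
      derivative^[k + 1] (legendrePoly (n + 2)) - derivative^[k + 1] (legendrePoly n) := by
  rw [← iterate_derivative_sub, ← mul_legendrePolyPrimitive, iterate_derivative_C_mul,
    Function.iterate_succ_apply, derivative_legendrePolyPrimitive]

/-- Bonnet's recursion. -/
theorem legendrePoly_bonnet (n : ℕ) :
    C (2 * (n : ℝ) + 3) * (legendrePoly (n + 1) * X) =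
      C ((n : ℝ) + 2) * legendrePoly (n + 2) + C ((n : ℝ) + 1) * legendrePoly n := by
  have h1 := legendrePoly_add_two n
  have h2 := mul_legendrePolyPrimitive n
  simp only [map_mul, map_add, map_natCast, map_ofNat, map_one] at *
  linear_combination (-(2 * (n : ℝ[X]) + 3)) * h1 - ((n : ℝ[X]) + 1) * h2

theorem iterate_derivative_legendrePoly_mul_X (n k : ℕ) :
    C (2 * (n : ℝ) + 3) * (derivative^[k + 1] (legendrePoly (n + 1)) * X) =
      C ((n : ℝ) + 1 - k) * derivative^[k + 1] (legendrePoly (n + 2)) +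
        C ((n : ℝ) + 2 + k) * derivative^[k + 1] (legendrePoly n) := by
  have h1 := congrArg (derivative^[k + 1]) (legendrePoly_bonnet n)
  have h2 := iterate_derivative_legendrePoly_sub n k
  rw [iterate_map_add, iterate_derivative_C_mul, iterate_derivative_C_mul,
    iterate_derivative_C_mul, iterate_derivative_mul_X, Nat.add_sub_cancel] at h1
  simp only [nsmul_eq_mul, map_mul, map_add, map_sub, map_natCast, map_ofNat, map_one] at *
  push_cast at h1
  linear_combination h1 - ((k : ℝ[X]) + 1) * h2

theorem iterate_derivative_legendrePoly_mul_X_sq_sub_one (n k : ℕ) :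
    C (2 * (n : ℝ) + 3) * ((X ^ 2 - 1) * derivative^[k + 1] (legendrePoly (n + 1))) =
      C (((n : ℝ) + 1 - k) * ((n : ℝ) + 2 - k)) * derivative^[k] (legendrePoly (n + 2)) -
        C (((n : ℝ) + 2 + k) * ((n : ℝ) + 1 + k)) * derivative^[k] (legendrePoly n) := by
  induction k with
  | zero =>
    have h1 := X_sq_sub_one_mul_derivative_legendrePoly n
    have h2 := mul_legendrePolyPrimitive n
    simp only [zero_add, Function.iterate_one, Function.iterate_zero, id_eq, Nat.cast_zero,
      map_mul, map_add, map_sub, map_natCast, map_ofNat, map_one, map_zero] at *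
    linear_combination (2 * (n : ℝ[X]) + 3) * h1 + ((n : ℝ[X]) + 1) * ((n : ℝ[X]) + 2) * h2
  | succ k ih =>
    have h1 := congrArg derivative ih
    have h2 := iterate_derivative_legendrePoly_mul_X n k
    rw [derivative_sub] at h1
    simp only [derivative_C_mul] at h1
    simp only [derivative_mul, derivative_sub, derivative_X_pow,
      derivative_one, ← Function.iterate_succ_apply' derivative] at h1
    simp only [Nat.succ_eq_add_one, Nat.cast_add, Nat.cast_one, map_mul, map_add, map_sub,
      map_natCast, map_ofNat, map_one] at *
    linear_combination h1 - 2 * h2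

theorem iterate_derivative_legendrePoly_eq_zero {l k : ℕ} (h : l < k) :
    derivative^[k] (legendrePoly l) = 0 := by
  rw [legendrePoly, iterate_derivative_C_mul, ← Function.iterate_add_apply,
    iterate_derivative_eq_zero, mul_zero]
  have : ((X ^ 2 - 1 : ℝ[X]) ^ l).natDegree ≤ l * 2 := by compute_degree
  lia

end LegendrePoly

/-- The normalisation constant of `Y_{lm}` for `l = m + j`. -/
noncomputable def sphHarmNorm (m j : ℕ) : ℝ :=
  Real.sqrt ((2 * ((m : ℝ) + j) + 1) / (4 * Real.pi) *
    ((Nat.factorial j : ℝ) / (Nat.factorial (2 * m + j) : ℝ)))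

theorem assocLegendreNat_cos (l m : ℕ) {θ : ℝ} (hθ : θ ∈ Set.Icc (0 : ℝ) Real.pi) :
    assocLegendreNat l m (Real.cos θ) = (-1) ^ m * Real.sin θ ^ m *
      (Polynomial.derivative^[m] (legendrePoly l)).eval (Real.cos θ) := by
  rw [assocLegendreNat, legendreP_eq_eval, iteratedDeriv_polynomial_eval,
    ← Real.sin_sq, Real.sqrt_sq (Real.sin_nonneg_of_mem_Icc hθ)]

theorem sphHarm_natCast (m j : ℕ) {θ : ℝ} (hθ : θ ∈ Set.Icc (0 : ℝ) Real.pi) (φ : ℝ) :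
    sphHarm ((m : ℤ) + j) m θ φ =
      ((sphHarmNorm m j * ((-1) ^ m * Real.sin θ ^ m *
        (Polynomial.derivative^[m] (legendrePoly (m + j))).eval (Real.cos θ)) : ℝ) : ℂ) *
      Complex.exp (Complex.I * (m : ℂ) * (φ : ℂ)) := by
  have h1 : ((m : ℤ) + j - m).toNat = j := by lia
  have h2 : ((m : ℤ) + j + m).toNat = 2 * m + j := by lia
  have h3 : ((m : ℤ) + j).toNat = m + j := by lia
  have h4 : 0 ≤ (m : ℤ) + j ∧ |(m : ℤ)| ≤ m + j := by rw [abs_of_nonneg] <;> lia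
  rw [sphHarm, if_pos h4, h1, h2, h3, assocLegendre, if_pos (by lia), Int.toNat_natCast,
    assocLegendreNat_cos _ _ hθ, sphHarmNorm]
  push_cast
  rfl

theorem sqrt_eq_sqrt_mul {a b c : ℝ} (hc : 0 ≤ c) (h : a = b * c ^ 2) :
    Real.sqrt a = Real.sqrt b * c := by
  rw [h, Real.sqrt_mul' _ (sq_nonneg c), Real.sqrt_sq hc]

theorem sphHarm_neg_natCast (m j : ℕ) {θ : ℝ} (hθ : θ ∈ Set.Icc (0 : ℝ) Real.pi) (φ : ℝ) :
    sphHarm ((m : ℤ) + j) (-(m : ℤ)) θ φ =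
      ((sphHarmNorm m j * (Real.sin θ ^ m *
        (Polynomial.derivative^[m] (legendrePoly (m + j))).eval (Real.cos θ)) : ℝ) : ℂ) *
      Complex.exp (-(Complex.I * (m : ℂ) * (φ : ℂ))) := by
  rcases Nat.eq_zero_or_pos m with rfl | hm
  · simpa using sphHarm_natCast 0 j hθ φ
  have h1 : ((m : ℤ) + j - -(m : ℤ)).toNat = 2 * m + j := by lia
  have h2 : ((m : ℤ) + j + -(m : ℤ)).toNat = j := by lia
  have h3 : ((m : ℤ) + j).toNat = m + j := by lia
  have h4 : 0 ≤ (m : ℤ) + j ∧ |-(m : ℤ)| ≤ m + j := by rw [abs_neg, abs_of_nonneg] <;> lia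
  have h5 : m + j - m = j := by lia
  have h6 : m + j + m = 2 * m + j := by lia
  have hN : sphHarmNorm m j = Real.sqrt ((2 * ((m : ℝ) + j) + 1) / (4 * Real.pi) *
      ((Nat.factorial (2 * m + j) : ℝ) / (Nat.factorial j : ℝ))) *
      ((Nat.factorial j : ℝ) / (Nat.factorial (2 * m + j) : ℝ)) := by
    rw [sphHarmNorm]
    apply sqrt_eq_sqrt_mul (by positivity)
    field_simp
  have hs : ((-1 : ℝ) ^ m) * (-1) ^ m = 1 := by rw [← mul_pow]; simp
  rw [sphHarm, if_pos h4, h1, h2, h3, assocLegendre, if_neg (by lia), Int.natAbs_neg,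
    Int.natAbs_natCast, h5, h6, assocLegendreNat_cos _ _ hθ, hN]
  congr 2
  · push_cast
    linear_combination (Real.sqrt ((2 * ((m : ℝ) + j) + 1) / (4 * Real.pi) *
      ((Nat.factorial (2 * m + j) : ℝ) / (Nat.factorial j : ℝ))) *
      ((Nat.factorial j : ℝ) / (Nat.factorial (2 * m + j) : ℝ)) * Real.sin θ ^ m *
        (Polynomial.derivative^[m] (legendrePoly (m + j))).eval (Real.cos θ)) * hs
  · push_cast
    ring

theorem sqrt_mul_sphHarmNorm_add_two (m j : ℕ) :
    Real.sqrt ((((j : ℝ) + 1) * ((j : ℝ) + 2)) /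
        ((2 * ((m : ℝ) + 1 + j) + 1) * (2 * ((m : ℝ) + 1 + j) + 3))) * sphHarmNorm m (j + 2) =
      sphHarmNorm (m + 1) j *
        (((j : ℝ) + 1) * ((j : ℝ) + 2) / (2 * ((m : ℝ) + 1 + j) + 1)) := by
  rw [sphHarmNorm, sphHarmNorm, ← Real.sqrt_mul (by positivity)]
  apply sqrt_eq_sqrt_mul (by positivity)
  rw [show 2 * m + (j + 2) = 2 * (m + 1) + j by ring, Nat.factorial_succ (j + 1),
    Nat.factorial_succ j]
  push_cast
  field_simp
  ring

theorem sqrt_mul_sphHarmNorm_same (m j : ℕ) :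
    Real.sqrt (((2 * (m : ℝ) + j + 2) * (2 * (m : ℝ) + j + 1)) /
        ((2 * ((m : ℝ) + 1 + j) - 1) * (2 * ((m : ℝ) + 1 + j) + 1))) * sphHarmNorm m j =
      sphHarmNorm (m + 1) j *
        ((2 * (m : ℝ) + j + 2) * (2 * (m : ℝ) + j + 1) / (2 * ((m : ℝ) + 1 + j) + 1)) := by
  have h : 2 * ((m : ℝ) + 1 + j) - 1 = 2 * ((m : ℝ) + j) + 1 := by ring
  rw [h, sphHarmNorm, sphHarmNorm, ← Real.sqrt_mul (by positivity)]
  apply sqrt_eq_sqrt_mul (by positivity)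
  rw [show 2 * (m + 1) + j = 2 * m + j + 1 + 1 by ring, Nat.factorial_succ (2 * m + j + 1),
    Nat.factorial_succ (2 * m + j)]
  push_cast
  field_simp
  ring

theorem sqrt_mul_sphHarmNorm_succ (m j : ℕ) :
    Real.sqrt (((2 * (m : ℝ) + j + 1) * (2 * (m : ℝ) + j + 2)) /
        ((2 * ((m : ℝ) + j) + 1) * (2 * ((m : ℝ) + j) + 3))) * sphHarmNorm (m + 1) j =
      sphHarmNorm m j * (1 / (2 * ((m : ℝ) + j) + 1)) := by
  rw [sphHarmNorm, sphHarmNorm, ← Real.sqrt_mul (by positivity)]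
  apply sqrt_eq_sqrt_mul (by positivity)
  rw [show 2 * (m + 1) + j = 2 * m + j + 1 + 1 by ring, Nat.factorial_succ (2 * m + j + 1),
    Nat.factorial_succ (2 * m + j)]
  push_cast
  field_simp
  ring

theorem sqrt_mul_sphHarmNorm_succ_sub_two (m j : ℕ) :
    Real.sqrt ((((j : ℝ) + 2) * ((j : ℝ) + 1)) /
        ((2 * ((m : ℝ) + j + 2) - 1) * (2 * ((m : ℝ) + j + 2) + 1))) * sphHarmNorm (m + 1) j =
      sphHarmNorm m (j + 2) * (1 / (2 * ((m : ℝ) + j + 2) + 1)) := by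
  have h : 2 * ((m : ℝ) + j + 2) - 1 = 2 * ((m : ℝ) + j) + 3 := by ring
  rw [h, sphHarmNorm, sphHarmNorm, ← Real.sqrt_mul (by positivity)]
  apply sqrt_eq_sqrt_mul (by positivity)
  rw [show 2 * (m + 1) + j = 2 * m + (j + 2) by ring, Nat.factorial_succ (j + 1),
    Nat.factorial_succ j]
  push_cast
  field_simp
  ring

/-- The recursion for positive order `m + 1` and degree `m + 1 + j`. -/
theorem sin_exp_neg_mul_sphHarm_natCast_succ (m j : ℕ) {θ : ℝ}
    (hθ : θ ∈ Set.Icc (0 : ℝ) Real.pi) (φ : ℝ) :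
    ((Real.sin θ : ℝ) : ℂ) * Complex.exp (-(Complex.I * (φ : ℂ))) *
        sphHarm ((m + 1 : ℕ) + (j : ℕ)) (m + 1 : ℕ) θ φ =
      ((Real.sqrt ((((j : ℝ) + 1) * ((j : ℝ) + 2)) /
        ((2 * ((m : ℝ) + 1 + j) + 1) * (2 * ((m : ℝ) + 1 + j) + 3))) : ℝ) : ℂ) *
          sphHarm (m + (j + 2 : ℕ)) m θ φ -
      ((Real.sqrt (((2 * (m : ℝ) + j + 2) * (2 * (m : ℝ) + j + 1)) /
        ((2 * ((m : ℝ) + 1 + j) - 1) * (2 * ((m : ℝ) + 1 + j) + 1))) : ℝ) : ℂ) *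
          sphHarm (m + j) m θ φ := by
  have hexp : Complex.exp (Complex.I * ((m + 1 : ℕ) : ℂ) * (φ : ℂ)) =
      Complex.exp (Complex.I * (φ : ℂ)) * Complex.exp (Complex.I * (m : ℂ) * (φ : ℂ)) := by
    rw [← Complex.exp_add]
    push_cast
    ring_nf
  have hexp' : Complex.exp (-(Complex.I * (φ : ℂ))) * Complex.exp (Complex.I * (φ : ℂ)) = 1 := by
    rw [← Complex.exp_add]; simp
  rw [sphHarm_natCast _ _ hθ, sphHarm_natCast _ _ hθ, sphHarm_natCast _ _ hθ, hexp]
  have hp := congrArg (Polynomial.eval (Real.cos θ))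
    (iterate_derivative_legendrePoly_mul_X_sq_sub_one (m + j) m)
  simp only [Polynomial.eval_mul, Polynomial.eval_sub, Polynomial.eval_C, Polynomial.eval_pow,
    Polynomial.eval_X, Polynomial.eval_one] at hp
  rw [show m + 1 + j = m + j + 1 by ring, show m + (j + 2) = m + j + 2 by ring]
  have hA := sqrt_mul_sphHarmNorm_add_two m j
  have hB := sqrt_mul_sphHarmNorm_same m j
  set A := Real.sqrt ((((j : ℝ) + 1) * ((j : ℝ) + 2)) /
        ((2 * ((m : ℝ) + 1 + j) + 1) * (2 * ((m : ℝ) + 1 + j) + 3)))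
  set B := Real.sqrt (((2 * (m : ℝ) + j + 2) * (2 * (m : ℝ) + j + 1)) /
        ((2 * ((m : ℝ) + 1 + j) - 1) * (2 * ((m : ℝ) + 1 + j) + 1)))
  set p := (Polynomial.derivative^[m + 1] (legendrePoly (m + j + 1))).eval (Real.cos θ)
  set q := (Polynomial.derivative^[m] (legendrePoly (m + j + 2))).eval (Real.cos θ)
  set r := (Polynomial.derivative^[m] (legendrePoly (m + j))).eval (Real.cos θ)
  have hreal : Real.sin θ * (sphHarmNorm (m + 1) j * ((-1) ^ (m + 1) * Real.sin θ ^ (m + 1) * p)) =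
      A * (sphHarmNorm m (j + 2) * ((-1) ^ m * Real.sin θ ^ m * q)) -
      B * (sphHarmNorm m j * ((-1) ^ m * Real.sin θ ^ m * r)) := by
    have hs : Real.sin θ ^ 2 = 1 - Real.cos θ ^ 2 := Real.sin_sq θ
    have hd : 2 * ((m : ℝ) + 1 + j) + 1 ≠ 0 := by positivity
    have hp' : -(Real.sin θ ^ 2 * p) =
        ((j : ℝ) + 1) * ((j : ℝ) + 2) / (2 * ((m : ℝ) + 1 + j) + 1) * q -
        (2 * (m : ℝ) + j + 2) * (2 * (m : ℝ) + j + 1) / (2 * ((m : ℝ) + 1 + j) + 1) * r := by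
      rw [hs]
      push_cast at hp
      field_simp
      linear_combination hp
    linear_combination (sphHarmNorm (m + 1) j * (-1) ^ m * Real.sin θ ^ m) * hp' -
      ((-1) ^ m * Real.sin θ ^ m * q) * hA + ((-1) ^ m * Real.sin θ ^ m * r) * hB
  have hc := congrArg (fun x : ℝ => (x : ℂ)) hreal
  simp only [Complex.ofReal_mul, Complex.ofReal_sub] at hc ⊢
  linear_combination (Complex.exp (Complex.I * (m : ℂ) * (φ : ℂ))) * hc +
    ((Real.sin θ : ℂ) * ((sphHarmNorm (m + 1) j : ℂ) * ((((-1 : ℝ) ^ (m + 1) : ℝ) : ℂ) *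
      ((Real.sin θ ^ (m + 1) : ℝ) : ℂ) * (p : ℂ))) *
      Complex.exp (Complex.I * (m : ℂ) * (φ : ℂ))) * hexp'

theorem exp_neg_mul_exp_neg_natCast (m : ℕ) (φ : ℝ) :
    Complex.exp (-(Complex.I * ((m + 1 : ℕ) : ℂ) * (φ : ℂ))) =
      Complex.exp (-(Complex.I * (φ : ℂ))) * Complex.exp (-(Complex.I * (m : ℂ) * (φ : ℂ))) := by
  rw [← Complex.exp_add]
  push_cast
  ring_nf

/-- The recursion for nonpositive order `-m` and degree `m + j + 2`. -/
theorem sin_exp_neg_mul_sphHarm_neg_natCast (m j : ℕ) {θ : ℝ}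
    (hθ : θ ∈ Set.Icc (0 : ℝ) Real.pi) (φ : ℝ) :
    ((Real.sin θ : ℝ) : ℂ) * Complex.exp (-(Complex.I * (φ : ℂ))) *
        sphHarm ((m : ℕ) + (j + 2 : ℕ)) (-(m : ℕ)) θ φ =
      ((Real.sqrt (((2 * (m : ℝ) + (j + 2 : ℕ) + 1) * (2 * (m : ℝ) + (j + 2 : ℕ) + 2)) /
        ((2 * ((m : ℝ) + (j + 2 : ℕ)) + 1) * (2 * ((m : ℝ) + (j + 2 : ℕ)) + 3))) : ℝ) : ℂ) *
          sphHarm ((m + 1 : ℕ) + (j + 2 : ℕ)) (-(m + 1 : ℕ)) θ φ -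
      ((Real.sqrt ((((j : ℝ) + 2) * ((j : ℝ) + 1)) /
        ((2 * ((m : ℝ) + j + 2) - 1) * (2 * ((m : ℝ) + j + 2) + 1))) : ℝ) : ℂ) *
          sphHarm ((m + 1 : ℕ) + j) (-(m + 1 : ℕ)) θ φ := by
  rw [sphHarm_neg_natCast _ _ hθ, sphHarm_neg_natCast _ _ hθ, sphHarm_neg_natCast _ _ hθ,
    exp_neg_mul_exp_neg_natCast]
  have hp := congrArg (Polynomial.eval (Real.cos θ))
    (iterate_derivative_legendrePoly_sub (m + j + 1) m)
  simp only [Polynomial.eval_mul, Polynomial.eval_sub, Polynomial.eval_C] at hp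
  rw [show m + (j + 2) = m + j + 1 + 1 by ring, show m + 1 + (j + 2) = m + j + 1 + 2 by ring,
    show m + 1 + j = m + j + 1 by ring]
  have hA := sqrt_mul_sphHarmNorm_succ m (j + 2)
  have hB := sqrt_mul_sphHarmNorm_succ_sub_two m j
  set A := Real.sqrt (((2 * (m : ℝ) + (j + 2 : ℕ) + 1) * (2 * (m : ℝ) + (j + 2 : ℕ) + 2)) /
        ((2 * ((m : ℝ) + (j + 2 : ℕ)) + 1) * (2 * ((m : ℝ) + (j + 2 : ℕ)) + 3)))
  set B := Real.sqrt ((((j : ℝ) + 2) * ((j : ℝ) + 1)) /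
        ((2 * ((m : ℝ) + j + 2) - 1) * (2 * ((m : ℝ) + j + 2) + 1)))
  set p := (Polynomial.derivative^[m] (legendrePoly (m + j + 1 + 1))).eval (Real.cos θ)
  set q := (Polynomial.derivative^[m + 1] (legendrePoly (m + j + 1 + 2))).eval (Real.cos θ)
  set r := (Polynomial.derivative^[m + 1] (legendrePoly (m + j + 1))).eval (Real.cos θ)
  have hreal : Real.sin θ * (sphHarmNorm m (j + 2) * (Real.sin θ ^ m * p)) =
      A * (sphHarmNorm (m + 1) (j + 2) * (Real.sin θ ^ (m + 1) * q)) -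
      B * (sphHarmNorm (m + 1) j * (Real.sin θ ^ (m + 1) * r)) := by
    have hp' : p = 1 / (2 * ((m : ℝ) + j + 2) + 1) * (q - r) := by
      push_cast at hp
      field_simp
      linear_combination hp
    have hA' : A * sphHarmNorm (m + 1) (j + 2) =
        sphHarmNorm m (j + 2) * (1 / (2 * ((m : ℝ) + j + 2) + 1)) := by
      rw [hA]
      push_cast
      ring
    linear_combination (sphHarmNorm m (j + 2) * Real.sin θ ^ (m + 1)) * hp' -
      (Real.sin θ ^ (m + 1) * q) * hA' + (Real.sin θ ^ (m + 1) * r) * hB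
  have hc := congrArg (fun x : ℝ => (x : ℂ)) hreal
  simp only [Complex.ofReal_mul, Complex.ofReal_sub] at hc ⊢
  linear_combination (Complex.exp (-(Complex.I * (φ : ℂ))) *
    Complex.exp (-(Complex.I * (m : ℂ) * (φ : ℂ)))) * hc

/-- The recursion for order `-m` and degree `m + j` with `j ≤ 1`, where the lower term vanishes. -/
theorem sin_exp_neg_mul_sphHarm_neg_natCast_of_le_one (m : ℕ) {j : ℕ} (hj : j ≤ 1) {θ : ℝ}
    (hθ : θ ∈ Set.Icc (0 : ℝ) Real.pi) (φ : ℝ) :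
    ((Real.sin θ : ℝ) : ℂ) * Complex.exp (-(Complex.I * (φ : ℂ))) *
        sphHarm ((m : ℕ) + (j : ℕ)) (-(m : ℕ)) θ φ =
      ((Real.sqrt (((2 * (m : ℝ) + j + 1) * (2 * (m : ℝ) + j + 2)) /
        ((2 * ((m : ℝ) + j) + 1) * (2 * ((m : ℝ) + j) + 3))) : ℝ) : ℂ) *
          sphHarm ((m + 1 : ℕ) + (j : ℕ)) (-(m + 1 : ℕ)) θ φ := by
  rw [sphHarm_neg_natCast _ _ hθ, sphHarm_neg_natCast _ _ hθ, exp_neg_mul_exp_neg_natCast]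
  have hpoly : Polynomial.C (2 * ((m : ℝ) + j) + 1) *
      Polynomial.derivative^[m] (legendrePoly (m + j)) =
      Polynomial.derivative^[m + 1] (legendrePoly (m + 1 + j)) := by
    rcases Nat.eq_zero_or_pos (m + j) with h0 | hpos
    · obtain ⟨rfl, rfl⟩ : m = 0 ∧ j = 0 := by lia
      simp [legendrePoly, mul_comm (Polynomial.C (2⁻¹ : ℝ)), one_add_one_eq_two,
        ← Polynomial.C_mul]
    · obtain ⟨n, hn⟩ : ∃ n, m + j = n + 1 := ⟨m + j - 1, by lia⟩
      have h := iterate_derivative_legendrePoly_sub n m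
      rw [iterate_derivative_legendrePoly_eq_zero (l := n) (by lia), sub_zero] at h
      have hn' : (m : ℝ) + j = n + 1 := by exact_mod_cast hn
      rw [hn, show m + 1 + j = n + 2 by lia, ← h, hn']
      congr 2
      ring
  have hp := congrArg (Polynomial.eval (Real.cos θ)) hpoly
  simp only [Polynomial.eval_mul, Polynomial.eval_C] at hp
  have hA := sqrt_mul_sphHarmNorm_succ m j
  set A := Real.sqrt (((2 * (m : ℝ) + j + 1) * (2 * (m : ℝ) + j + 2)) /
        ((2 * ((m : ℝ) + j) + 1) * (2 * ((m : ℝ) + j) + 3)))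
  set p := (Polynomial.derivative^[m] (legendrePoly (m + j))).eval (Real.cos θ)
  set q := (Polynomial.derivative^[m + 1] (legendrePoly (m + 1 + j))).eval (Real.cos θ)
  have hreal : Real.sin θ * (sphHarmNorm m j * (Real.sin θ ^ m * p)) =
      A * (sphHarmNorm (m + 1) j * (Real.sin θ ^ (m + 1) * q)) := by
    have hp' : p = 1 / (2 * ((m : ℝ) + j) + 1) * q := by
      field_simp
      linear_combination hp
    linear_combination (sphHarmNorm m j * Real.sin θ ^ (m + 1)) * hp' -
      (Real.sin θ ^ (m + 1) * q) * hA
  have hc := congrArg (fun x : ℝ => (x : ℂ)) hreal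
  simp only [Complex.ofReal_mul] at hc ⊢
  linear_combination (Complex.exp (-(Complex.I * (φ : ℂ))) *
    Complex.exp (-(Complex.I * (m : ℂ) * (φ : ℂ)))) * hc

/-- **Recursion for `sin θ e^{-iφ} Y_{lm}`:**
`sin θ e^{-iφ} Y_{lm} = √(((l-m+1)(l-m+2))/((2l+1)(2l+3))) Y_{l+1,m-1}
 - √(((l+m)(l+m-1))/((2l-1)(2l+1))) Y_{l-1,m-1}`,
with the convention that `Y_{l'm'} = 0` when `l' < 0` or `|m'| > l'`. -/
theorem sin_exp_neg_mul_sphHarm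
    (l m : ℤ) (hl : 0 ≤ l) (hm : |m| ≤ l) :
    ∀ θ ∈ Set.Icc (0 : ℝ) Real.pi, ∀ φ ∈ Set.Ico (0 : ℝ) (2 * Real.pi),
      ((Real.sin θ : ℝ) : ℂ) * Complex.exp (-(Complex.I * (φ : ℂ))) * sphHarm l m θ φ =
        ((Real.sqrt ((((l : ℝ) - (m : ℝ) + 1) * ((l : ℝ) - (m : ℝ) + 2)) /
            ((2 * (l : ℝ) + 1) * (2 * (l : ℝ) + 3))) : ℝ) : ℂ) * sphHarm (l + 1) (m - 1) θ φ -
        ((Real.sqrt ((((l : ℝ) + (m : ℝ)) * ((l : ℝ) + (m : ℝ) - 1)) /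
            ((2 * (l : ℝ) - 1) * (2 * (l : ℝ) + 1))) : ℝ) : ℂ) * sphHarm (l - 1) (m - 1) θ φ := by
  intro θ hθ φ _
  rcases le_or_gt m 0 with hm0 | hm0
  · obtain ⟨k, rfl⟩ : ∃ k : ℕ, m = -(k : ℤ) := ⟨m.natAbs, by lia⟩
    rw [abs_neg, abs_of_nonneg (by lia)] at hm
    obtain ⟨j, rfl⟩ : ∃ j : ℕ, l = k + j := ⟨(l - k).toNat, by lia⟩
    rcases le_or_gt j 1 with hj | hj
    · have hB : ((((k : ℤ) + j : ℤ) : ℝ) + ((-(k : ℤ) : ℤ) : ℝ)) *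
          ((((k : ℤ) + j : ℤ) : ℝ) + ((-(k : ℤ) : ℤ) : ℝ) - 1) = 0 := by
        push_cast
        interval_cases j <;> simp
      rw [hB, zero_div, Real.sqrt_zero, Complex.ofReal_zero, zero_mul, sub_zero]
      convert! sin_exp_neg_mul_sphHarm_neg_natCast_of_le_one k hj hθ φ using 3
      · congr 3 <;> push_cast <;> ring
      · push_cast; ring
      · push_cast; ring
    · obtain ⟨i, rfl⟩ : ∃ i, j = i + 2 := ⟨j - 2, by lia⟩
      convert! sin_exp_neg_mul_sphHarm_neg_natCast k i hθ φ using 3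
      · congr 3 <;> push_cast <;> ring
      · congr 1 <;> push_cast <;> ring
      · congr 3 <;> push_cast <;> ring
      · congr 1 <;> push_cast <;> ring
  · obtain ⟨k, rfl⟩ : ∃ k : ℕ, m = ((k + 1 : ℕ) : ℤ) := ⟨(m - 1).toNat, by lia⟩
    rw [abs_of_nonneg (by lia)] at hm
    obtain ⟨j, rfl⟩ : ∃ j : ℕ, l = (k + 1 : ℕ) + j := ⟨(l - (k + 1 : ℕ)).toNat, by lia⟩
    convert! sin_exp_neg_mul_sphHarm_natCast_succ k j hθ φ using 3
    · congr 3 <;> push_cast <;> ring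
    · congr 1 <;> push_cast <;> ring
    · congr 3 <;> push_cast <;> ring
    · congr 1 <;> push_cast <;> ring
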